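/- arXiv:2405.07211 — 2 statements merged into one kernel-verified Lean document; each statement's English description precedes it below -/
import Mathlib

section
/- Let d be an even positive integer, let η = Σ_{0 ≤ i < j ≤ d-1} (-1)^{i+j} (i j) in the group algebra ℂ[S_d], and let g ∈ S_d be the cyclic permutation sending i to i+1 (mod d). Then g·η·g^{-1} = η; equivalently, η commutes with g (and hence with the cyclic subgroup ℤ_d generated by g) in ℂ[S_d]. -/
open MonoidAlgebra Finset

/-- The sign `(-1)^i` of an index flips under the successor modulo an even number. -/
theorem neg_one_pow_val_add_one {R : Type*} [Ring R] {d : ℕ} [NeZero d] (hd : Even d)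
    (i : Fin d) : (-1 : R) ^ ((i + 1 : Fin d) : ℕ) = -(-1) ^ (i : ℕ) := by
  obtain ⟨n, rfl⟩ := Nat.exists_eq_succ_of_ne_zero (NeZero.ne d)
  rw [Fin.val_add_one]
  split_ifs with h
  · have hn : Odd n := by
      rw [← Nat.not_even_iff_odd]
      exact fun hn => (Nat.even_add_one.mp hd) hn
    simp [h, hn.neg_one_pow]
  · simp [pow_succ]

/-- The image of a pair under a permutation, with its entries put in increasing order. -/
def sortedImage {α : Type*} [LinearOrder α] (g : Equiv.Perm α) (p : α × α) : α × α :=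
  if g p.1 < g p.2 then (g p.1, g p.2) else (g p.2, g p.1)

theorem sortedImage_fst_lt_snd {α : Type*} [LinearOrder α] (g : Equiv.Perm α) {p : α × α}
    (hp : p.1 < p.2) : (sortedImage g p).1 < (sortedImage g p).2 := by
  unfold sortedImage
  split_ifs with h
  · exact h
  · exact lt_of_le_of_ne (not_lt.mp h) (g.injective.ne hp.ne')

theorem sortedImage_of_mul_eq_one {α : Type*} [LinearOrder α] {g h : Equiv.Perm α}
    (hgh : g * h = 1) {p : α × α} (hp : p.1 < p.2) :
    sortedImage g (sortedImage h p) = p := by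
  have hcancel : ∀ x, g (h x) = x := fun x => by
    rw [← Equiv.Perm.mul_apply, hgh, Equiv.Perm.one_apply]
  unfold sortedImage
  split_ifs <;> simp_all [hp.not_gt]

/-- A sum over increasing pairs of a symmetric function is invariant under permutations. -/
theorem sum_lt_pairs_comp_perm {α M : Type*} [LinearOrder α] [Fintype α] [AddCommMonoid M]
    (f : α → α → M) (hf : ∀ i j, f i j = f j i) (g : Equiv.Perm α) :
    ∑ p ∈ Finset.univ.filter (fun p : α × α => p.1 < p.2), f (g p.1) (g p.2) =
      ∑ p ∈ Finset.univ.filter (fun p : α × α => p.1 < p.2), f p.1 p.2 := by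
  refine Finset.sum_nbij' (sortedImage g) (sortedImage g⁻¹) ?_ ?_ ?_ ?_ ?_
  · intro p hp
    simpa using sortedImage_fst_lt_snd g (by simpa using hp)
  · intro p hp
    simpa using sortedImage_fst_lt_snd g⁻¹ (by simpa using hp)
  · intro p hp
    exact sortedImage_of_mul_eq_one (inv_mul_cancel g) (by simpa using hp)
  · intro p hp
    exact sortedImage_of_mul_eq_one (mul_inv_cancel g) (by simpa using hp)
  · intro p _
    unfold sortedImage
    split_ifs
    · rfl
    · exact hf _ _

/-- For `d` even, the signed sum of transpositions
`η = Σ_{0 ≤ i < j ≤ d-1} (-1)^{i+j} (i j)` in `ℂ[S_d]` commutes with the cyclic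
permutation `g : i ↦ i + 1 (mod d)`, i.e. `g·η·g⁻¹ = η`. -/
theorem signed_sum_transpositions_commutes_with_cycle (d : ℕ) [NeZero d] (hd : Even d)
    (η : MonoidAlgebra ℂ (Equiv.Perm (Fin d)))
    (hη : η = ∑ p ∈ Finset.univ.filter (fun p : Fin d × Fin d => p.1 < p.2),
      ((-1 : ℂ) ^ ((p.1 : ℕ) + (p.2 : ℕ))) •
        MonoidAlgebra.of ℂ (Equiv.Perm (Fin d)) (Equiv.swap p.1 p.2))
    (g : Equiv.Perm (Fin d)) (hg : ∀ i : Fin d, g i = i + 1) :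
    MonoidAlgebra.of ℂ (Equiv.Perm (Fin d)) g * η *
        (MonoidAlgebra.of ℂ (Equiv.Perm (Fin d)) g⁻¹) = η ∧
      MonoidAlgebra.of ℂ (Equiv.Perm (Fin d)) g * η
        = η * MonoidAlgebra.of ℂ (Equiv.Perm (Fin d)) g := by
  have hsign : ∀ i j : Fin d,
      (-1 : ℂ) ^ ((i : ℕ) + (j : ℕ)) = (-1) ^ ((g i : ℕ) + (g j : ℕ)) := fun i j => by
    rw [hg, hg, pow_add, pow_add, neg_one_pow_val_add_one hd, neg_one_pow_val_add_one hd,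
      neg_mul_neg]
  have hcomm : MonoidAlgebra.of ℂ (Equiv.Perm (Fin d)) g * η
      = η * MonoidAlgebra.of ℂ (Equiv.Perm (Fin d)) g := by
    have hsymm := sum_lt_pairs_comp_perm
      (fun i j : Fin d => ((-1 : ℂ) ^ ((i : ℕ) + (j : ℕ))) •
        MonoidAlgebra.of ℂ (Equiv.Perm (Fin d)) (Equiv.swap i j))
      (fun i j => by rw [add_comm, Equiv.swap_comm]) g
    subst hη
    conv_rhs => rw [← hsymm]
    rw [Finset.mul_sum, Finset.sum_mul]
    refine Finset.sum_congr rfl fun p _ => ?_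
    rw [mul_smul_comm, smul_mul_assoc, ← map_mul, ← map_mul, Equiv.mul_swap_eq_swap_mul,
      hsign]
  refine ⟨?_, hcomm⟩
  rw [hcomm, mul_assoc, ← map_mul, mul_inv_cancel, map_one, mul_one]
end

section
/- Let ℓ ≥ 1 and let B be the adjacency matrix of the ℓ-dimensional hypercube, with rows and columns indexed by bitstrings in (ℤ/2)^ℓ and B_{xy} = 1 if x and y differ in exactly one coordinate, 0 otherwise. A permutation π of (ℤ/2)^ℓ satisfies P_π · B = B · P_π if and only if there exist a permutation σ of {1,…,ℓ} and a bitstring t ∈ (ℤ/2)^ℓ such that π(x)_j = x_{σ(j)} + t_j for all x and j. That is, the centralizer of B among permutations of the 2^ℓ basis states is exactly the hyperoctahedral group K_ℓ ⋊ S_ℓ of bit flips and bit permutations. -/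
open Finset

/-- The permutation matrix of a permutation `π` of bitstrings. -/
def permMatrixBits (ℓ : ℕ) (π : Equiv.Perm (Fin ℓ → ZMod 2)) :
    Matrix (Fin ℓ → ZMod 2) (Fin ℓ → ZMod 2) ℝ :=
  Matrix.of fun x y : Fin ℓ → ZMod 2 => if x = π y then (1 : ℝ) else 0

/-- The adjacency matrix of the `ℓ`-dimensional hypercube: entry `1` between bitstrings
differing in exactly one coordinate, `0` otherwise (the transverse-field mixer `B`). -/
def hypercubeB (ℓ : ℕ) : Matrix (Fin ℓ → ZMod 2) (Fin ℓ → ZMod 2) ℝ :=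
  Matrix.of fun x y : Fin ℓ → ZMod 2 =>
    if (Finset.univ.filter fun j => x j ≠ y j).card = 1 then (1 : ℝ) else 0

/-- The entry of the hypercube adjacency matrix at `x`, `y` is `1` exactly when `y` arises from `x`
by one bit flip. -/
theorem card_filter_ne_eq_one_iff {ℓ : ℕ} (x y : Fin ℓ → ZMod 2) :
    (Finset.univ.filter fun j => x j ≠ y j).card = 1 ↔ ∃ i, y = x + Pi.single i 1 := by
  have zmod_two : ∀ a b : ZMod 2, a ≠ b ↔ b = a + 1 := by decide
  rw [Finset.card_eq_one]
  refine exists_congr fun i => ?_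
  rw [Finset.ext_iff, funext_iff]
  refine forall_congr' fun j => ?_
  rcases eq_or_ne j i with rfl | hj
  · simpa using zmod_two (x j) (y j)
  · simp [hj, eq_comm]

theorem hypercubeB_apply_eq_iff {ℓ : ℕ} (x y x' y' : Fin ℓ → ZMod 2) :
    hypercubeB ℓ x y = hypercubeB ℓ x' y' ↔
      ((∃ i, y = x + Pi.single i 1) ↔ ∃ i, y' = x' + Pi.single i 1) := by
  simp only [hypercubeB, Matrix.of_apply, card_filter_ne_eq_one_iff]
  split_ifs <;> simp_all

/-- A permutation matrix commutes with the hypercube adjacency matrix iff the permutation is a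
graph automorphism. -/
theorem permMatrixBits_commute_iff {ℓ : ℕ} (π : Equiv.Perm (Fin ℓ → ZMod 2)) :
    permMatrixBits ℓ π * hypercubeB ℓ = hypercubeB ℓ * permMatrixBits ℓ π ↔
      ∀ x y, (∃ i, y = x + Pi.single i 1) ↔ ∃ i, π y = π x + Pi.single i 1 := by
  have left_mul (x y) :
      (permMatrixBits ℓ π * hypercubeB ℓ) (π x) y = hypercubeB ℓ x y := by
    simp [Matrix.mul_apply, permMatrixBits]
  have mul_right (x y) :
      (hypercubeB ℓ * permMatrixBits ℓ π) (π x) y = hypercubeB ℓ (π x) (π y) := by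
    simp [Matrix.mul_apply, permMatrixBits]
  simp only [← hypercubeB_apply_eq_iff]
  rw [← Matrix.ext_iff, ← π.forall_congr_right]
  simp only [left_mul, mul_right]

/-- Bitstrings are generated from `0` by single bit flips. -/
theorem bits_induction {ℓ : ℕ} {p : (Fin ℓ → ZMod 2) → Prop} (zero : p 0)
    (flip : ∀ x j, p x → p (x + Pi.single j 1)) (x : Fin ℓ → ZMod 2) : p x := by
  have zmod_two : ∀ a : ZMod 2, a = 0 ∨ a = 1 := by decide
  rw [← Finset.univ_sum_single x]
  induction (Finset.univ : Finset (Fin ℓ)) using Finset.induction_on with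
  | empty => simpa using zero
  | insert j s hj ih =>
    rw [Finset.sum_insert hj, add_comm]
    rcases zmod_two (x j) with h | h
    · simpa [h] using ih
    · rw [h]
      exact flip _ _ ih

theorem single_one_injective {ℓ : ℕ} :
    Function.Injective fun i : Fin ℓ => (Pi.single i 1 : Fin ℓ → ZMod 2) := by
  intro i j h
  by_contra hij
  simpa [hij] using congrFun h i

theorem bits_add_self {ℓ : ℕ} (x : Fin ℓ → ZMod 2) : x + x = 0 :=
  funext fun j => CharTwo.add_self_eq_zero (x j)

theorem eq_of_single_add_single_eq {ℓ : ℕ} {a b c d : Fin ℓ}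
    (h : (Pi.single a 1 + Pi.single b 1 : Fin ℓ → ZMod 2) = Pi.single c 1 + Pi.single d 1)
    (hab : a ≠ b) (hac : a ≠ c) : a = d := by
  by_contra had
  simpa [hab, hac, had] using congrFun h a

/-- A hypercube automorphism maps all edges in one coordinate direction to edges in one coordinate
direction. -/
theorem exists_direction_map {ℓ : ℕ} {π : Equiv.Perm (Fin ℓ → ZMod 2)}
    (hπ : ∀ x i, ∃ k, π (x + Pi.single i 1) = π x + Pi.single k 1) :
    ∃ τ : Fin ℓ → Fin ℓ, Function.Injective τ ∧
      ∀ x i, π (x + Pi.single i 1) = π x + Pi.single (τ i) 1 := by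
  choose d hd using hπ
  have d_injective (x) : Function.Injective (d x) := by
    intro i j h
    have : π (x + Pi.single i 1) = π (x + Pi.single j 1) := by rw [hd, hd, h]
    exact single_one_injective (add_left_cancel (π.injective this))
  have d_flip (x j i) : d (x + Pi.single j 1) i = d x i := by
    rcases eq_or_ne i j with rfl | hij
    · have h := hd (x + Pi.single i 1) i
      rw [hd x i, add_assoc, bits_add_self, add_zero, add_assoc, left_eq_add] at h
      exact single_one_injective (funext fun k =>
        (CharTwo.add_eq_zero.1 (congrFun h k)).symm)
    · have hi := hd (x + Pi.single i 1) j
      have hj := hd (x + Pi.single j 1) i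
      rw [add_right_comm, hj, hd, hd, add_assoc, add_assoc, add_right_inj] at hi
      refine (eq_of_single_add_single_eq hi.symm ?_ ((d_injective x).ne hij)).symm
      intro h
      have back := hd (x + Pi.single i 1) j
      rw [hd x i, ← h, add_assoc (π x), bits_add_self, add_zero, π.apply_eq_iff_eq, add_assoc,
        add_eq_left] at back
      simpa [hij] using congrFun back i
  have d_const (x) : d x = d 0 :=
    bits_induction (p := fun x => d x = d 0) rfl
      (fun x j h => (funext (d_flip x j)).trans h) x
  exact ⟨d 0, d_injective 0, fun x i => by rw [hd, d_const]⟩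

/-- A permutation `π` of bitstrings commutes with the hypercube
adjacency matrix `B` if and only if it is a composition of bit permutations and bit flips:
`π(x)_j = x_{σ(j)} + t_j`.  That is, the centralizer of `B` among permutations of the
`2^ℓ` basis states is exactly the hyperoctahedral group `K_ℓ ⋊ S_ℓ`. -/
theorem hypercube_centralizer (ℓ : ℕ) (hl : 1 ≤ ℓ) (π : Equiv.Perm (Fin ℓ → ZMod 2)) :
    permMatrixBits ℓ π * hypercubeB ℓ = hypercubeB ℓ * permMatrixBits ℓ π
      ↔ ∃ (σ : Equiv.Perm (Fin ℓ)) (t : Fin ℓ → ZMod 2),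
          ∀ (x : Fin ℓ → ZMod 2) (j : Fin ℓ), π x j = x (σ j) + t j := by
  rw [permMatrixBits_commute_iff]
  constructor
  · intro h
    obtain ⟨τ, τ_injective, hτ⟩ := exists_direction_map fun x i => (h x _).1 ⟨i, rfl⟩
    have apply_τ (x) : ∀ i, π x (τ i) = x i + π 0 (τ i) := by
      induction x using bits_induction with
      | zero => simp
      | flip x j ih =>
        intro i
        simp only [hτ, Pi.add_apply, ih, Pi.single_apply, τ_injective.eq_iff]
        ring
    let e := Equiv.ofBijective τ (Finite.injective_iff_bijective.1 τ_injective)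
    refine ⟨e.symm, π 0, fun x j => ?_⟩
    obtain ⟨i, rfl⟩ := e.surjective j
    rw [e.symm_apply_apply]
    exact apply_τ x i
  · rintro ⟨σ, t, h⟩ x y
    rw [← σ.exists_congr_right]
    refine exists_congr fun i => ?_
    rw [funext_iff, funext_iff, ← σ.forall_congr_right]
    refine forall_congr' fun j => ?_
    simp only [h, Pi.add_apply, Pi.single_apply, σ.apply_eq_iff_eq]
    rw [add_right_comm, add_left_inj]
end
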